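/- Let d, m be positive integers, A a real m×d matrix, y ∈ ℝ^m, X̂₀, X_n, X_corrupt ∈ ℝ^d, T a real d×d matrix, σ_X > 0, σ_y > 0, and σ_n, σ̄_n > 0 with σ_N² = σ_n² + σ̄_n². Let Σ_X⁻¹ = (1/σ_X²)(I + Tᵀ T), let k_y = σ_X²/σ_y², k_e = (σ̄_n² σ_X²)/(σ_n² σ_N²), and X_{0,e} = (σ_N²/σ̄_n²) X_n − (σ_n²/σ̄_n²) X_corrupt, and let M = (1 − σ_n²/σ_N²) I + σ_n² Σ_X⁻¹ + (σ_n²/σ_y²) Aᵀ A. Then a vector X* ∈ ℝ^d satisfies the linear equation M X* = (X_n − (σ_n²/σ_N²) X_corrupt) + σ_n² Σ_X⁻¹ X̂₀ + (σ_n²/σ_y²) Aᵀ y if and only if X* is a global minimizer over ℝ^d of f(X) = ‖X − X̂₀‖₂² + k_y ‖A X − y‖₂² + k_e ‖X − X_{0,e}‖₂² + ‖T(X − X̂₀)‖₂²; moreover this minimizer is unique. -/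

import Mathlib

open Matrix

/-- A function with second-order expansion `f (x + h) = f x + 2 ⟪L x - b, h⟫ + ⟪L h, h⟫`, where
`L` is positive definite, is globally minimized exactly at the unique solution of `L x = b`. -/
theorem quadratic_minimizer_iff_and_existsUnique
    {E : Type*} [NormedAddCommGroup E] [InnerProductSpace ℝ E] [FiniteDimensional ℝ E]
    (L : E →ₗ[ℝ] E) (b : E) (f : E → ℝ)
    (hf : ∀ x h, f (x + h) = f x + 2 * inner ℝ (L x - b) h + inner ℝ (L h) h)
    (hL : ∀ h, h ≠ 0 → 0 < inner ℝ (L h) h) :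
    (∀ x, L x = b ↔ ∀ z, f x ≤ f z) ∧ ∃! x, ∀ z, f x ≤ f z := by
  have hiff : ∀ x, L x = b ↔ ∀ z, f x ≤ f z := by
    intro x
    constructor
    · intro hx z
      have hexp := hf x (z - x)
      rw [add_sub_cancel, hx, sub_self, inner_zero_left] at hexp
      rcases eq_or_ne (z - x) 0 with h | h
      · rw [sub_eq_zero.mp h]
      · linarith [hL _ h]
    · intro hmin
      by_contra hne
      have hr : L x - b ≠ 0 := sub_ne_zero.mpr hne
      set r := L x - b with hr_def
      have hq := hL r hr
      set q := inner ℝ (L r) r with hq_def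
      have hs : 0 < inner ℝ r r := real_inner_self_pos.mpr hr
      set s := inner ℝ r r with hs_def
      have hexp := hf x ((-(s / q)) • r)
      rw [← hr_def, map_smul, real_inner_smul_left, real_inner_smul_right,
        real_inner_smul_right, ← hq_def, ← hs_def] at hexp
      have hdec : 2 * (-(s / q) * s) + -(s / q) * (-(s / q) * q) = -(s ^ 2 / q) := by
        field_simp
        ring
      have hpos : 0 < s ^ 2 / q := by positivity
      linarith [hmin (x + (-(s / q)) • r)]
  have hinj : Function.Injective L := by
    rw [injective_iff_map_eq_zero]
    intro h hh
    by_contra hne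
    simpa [hh] using hL h hne
  obtain ⟨x, hx⟩ := LinearMap.surjective_of_injective hinj b
  exact ⟨hiff, x, (hiff x).mp hx, fun z hz => hinj (((hiff z).mpr hz).trans hx.symm)⟩

/-- The transpose of a real matrix acts as the adjoint on Euclidean space. -/
theorem inner_toEuclideanLin_transpose {m n : Type*} [Fintype m] [Fintype n]
    [DecidableEq m] [DecidableEq n] (A : Matrix m n ℝ)
    (u : EuclideanSpace ℝ m) (v : EuclideanSpace ℝ n) :
    inner ℝ (Aᵀ.toEuclideanLin u) v = inner ℝ u (A.toEuclideanLin v) := by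
  rw [← conjTranspose_eq_transpose_of_trivial, toEuclideanLin_conjTranspose_eq_adjoint,
    LinearMap.adjoint_inner_left]

theorem toEuclideanLin_mul_apply {l m n : Type*} [Fintype m] [Fintype n]
    [DecidableEq m] [DecidableEq n] (A : Matrix l m ℝ) (B : Matrix m n ℝ)
    (x : EuclideanSpace ℝ n) :
    (A * B).toEuclideanLin x = A.toEuclideanLin (B.toEuclideanLin x) := by
  simp [toLpLin_apply, mulVec_mulVec]

theorem norm_add_sub_sq {E : Type*} [NormedAddCommGroup E] [InnerProductSpace ℝ E] (x h c : E) :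
    ‖x + h - c‖ ^ 2 = ‖x - c‖ ^ 2 + 2 * inner ℝ (x - c) h + ‖h‖ ^ 2 := by
  rw [add_sub_right_comm, norm_add_sq_real]

/-- equations (22)–(27) of the paper: with
`Σ_X⁻¹ = (1/σ_X²)(I + TᵀT)`, `k_y = σ_X²/σ_y²`, `k_e = σ̄_n²σ_X²/(σ_n²σ_N²)`,
`X_{0,e} = (σ_N²/σ̄_n²)X_n − (σ_n²/σ̄_n²)X_corrupt` and
`M = (1 − σ_n²/σ_N²)I + σ_n²Σ_X⁻¹ + (σ_n²/σ_y²)AᵀA`, a vector `X*` solves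
`M X* = (X_n − (σ_n²/σ_N²)X_corrupt) + σ_n²Σ_X⁻¹X̂₀ + (σ_n²/σ_y²)Aᵀy` iff it is a global
minimizer of `f(X) = ‖X−X̂₀‖² + k_y‖AX−y‖² + k_e‖X−X_{0,e}‖² + ‖T(X−X̂₀)‖²`; and this
minimizer is unique. -/
theorem mesb_update_is_quadratic_minimizer
    (d m : ℕ) (hd : 0 < d) (hm : 0 < m)
    (A : Matrix (Fin m) (Fin d) ℝ) (y : EuclideanSpace ℝ (Fin m))
    (X0 Xn Xc : EuclideanSpace ℝ (Fin d))
    (T : Matrix (Fin d) (Fin d) ℝ)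
    (σX σy σn σbn : ℝ) (hσX : 0 < σX) (hσy : 0 < σy) (hσn : 0 < σn) (hσbn : 0 < σbn)
    (σN2 : ℝ) (hσN2 : σN2 = σn^2 + σbn^2)
    (SigXinv : Matrix (Fin d) (Fin d) ℝ)
    (hSigXinv : SigXinv = (1/σX^2) • ((1 : Matrix (Fin d) (Fin d) ℝ) + Tᵀ * T))
    (ky ke : ℝ) (hky : ky = σX^2/σy^2) (hke : ke = σbn^2 * σX^2 / (σn^2 * σN2))
    (X0e : EuclideanSpace ℝ (Fin d)) (hX0e : X0e = (σN2/σbn^2) • Xn - (σn^2/σbn^2) • Xc)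
    (M : Matrix (Fin d) (Fin d) ℝ)
    (hM : M = (1 - σn^2/σN2) • (1 : Matrix (Fin d) (Fin d) ℝ)
        + σn^2 • SigXinv + (σn^2/σy^2) • (Aᵀ * A))
    (f : EuclideanSpace ℝ (Fin d) → ℝ)
    (hf : ∀ X, f X = ‖X - X0‖^2 + ky * ‖A.toEuclideanLin X - y‖^2
        + ke * ‖X - X0e‖^2 + ‖T.toEuclideanLin (X - X0)‖^2) :
    (∀ Xs : EuclideanSpace ℝ (Fin d),
      M.toEuclideanLin Xs
          = (Xn - (σn^2/σN2) • Xc) + σn^2 • SigXinv.toEuclideanLin X0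
            + (σn^2/σy^2) • (Aᵀ).toEuclideanLin y
        ↔ ∀ X, f Xs ≤ f X)
    ∧ ∃! Xs : EuclideanSpace ℝ (Fin d), ∀ X, f Xs ≤ f X := by
  have hN : 0 < σN2 := by rw [hσN2]; positivity
  have hky0 : 0 < ky := by rw [hky]; positivity
  have hke0 : 0 < ke := by rw [hke]; positivity
  have hc : 0 < σn ^ 2 / σX ^ 2 := by positivity
  have hσ : 1 - σn ^ 2 / σN2 = σn ^ 2 / σX ^ 2 * ke := by
    rw [hke]
    field_simp
    linarith
  have hcky : σn ^ 2 / σy ^ 2 = σn ^ 2 / σX ^ 2 * ky := by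
    rw [hky]
    field_simp
  have hX : Xn - (σn ^ 2 / σN2) • Xc = (σn ^ 2 / σX ^ 2 * ke) • X0e := by
    rw [hX0e, hke, smul_sub, smul_smul, smul_smul]
    congr 1
    · rw [show σn ^ 2 / σX ^ 2 * (σbn ^ 2 * σX ^ 2 / (σn ^ 2 * σN2)) * (σN2 / σbn ^ 2) = 1 by
        field_simp, one_smul]
    · congr 1
      field_simp
  have hS : ∀ x, SigXinv.toEuclideanLin x
      = (1 / σX ^ 2) • (x + Tᵀ.toEuclideanLin (T.toEuclideanLin x)) := by
    intro x
    simp only [hSigXinv, map_smul, map_add, LinearMap.smul_apply, LinearMap.add_apply,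
      toEuclideanLin_mul_apply, toLpLin_one, LinearMap.id_apply]
  let L : EuclideanSpace ℝ (Fin d) →ₗ[ℝ] EuclideanSpace ℝ (Fin d) :=
    LinearMap.id + Tᵀ.toEuclideanLin ∘ₗ T.toEuclideanLin
      + ky • (Aᵀ.toEuclideanLin ∘ₗ A.toEuclideanLin) + ke • LinearMap.id
  have hLx : ∀ x, L x = x + Tᵀ.toEuclideanLin (T.toEuclideanLin x)
      + ky • Aᵀ.toEuclideanLin (A.toEuclideanLin x) + ke • x := fun _ => rfl
  let b := X0 + Tᵀ.toEuclideanLin (T.toEuclideanLin X0) + ky • Aᵀ.toEuclideanLin y + ke • X0e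
  have hMx : ∀ x, M.toEuclideanLin x = (σn ^ 2 / σX ^ 2) • L x := by
    intro x
    rw [hM, hσ, hcky]
    simp only [map_smul, map_add, LinearMap.smul_apply, LinearMap.add_apply,
      toEuclideanLin_mul_apply, toLpLin_one, LinearMap.id_apply, hS, hLx]
    module
  have hb : (Xn - (σn ^ 2 / σN2) • Xc) + σn ^ 2 • SigXinv.toEuclideanLin X0
      + (σn ^ 2 / σy ^ 2) • Aᵀ.toEuclideanLin y = (σn ^ 2 / σX ^ 2) • b := by
    rw [hX, hcky, hS]
    simp only [b]
    module
  have hquad : ∀ h, inner ℝ (L h) h = ‖h‖ ^ 2 + ‖T.toEuclideanLin h‖ ^ 2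
      + ky * ‖A.toEuclideanLin h‖ ^ 2 + ke * ‖h‖ ^ 2 := by
    intro h
    simp only [hLx, inner_add_left, real_inner_smul_left, inner_toEuclideanLin_transpose,
      real_inner_self_eq_norm_sq]
  have key := quadratic_minimizer_iff_and_existsUnique L b f
    (by
      intro x h
      have hgrad : L x - b = (x - X0) + Tᵀ.toEuclideanLin (T.toEuclideanLin (x - X0))
          + ky • Aᵀ.toEuclideanLin (A.toEuclideanLin x - y) + ke • (x - X0e) := by
        simp only [hLx, b, map_sub]
        module
      rw [hquad, hgrad]
      simp only [inner_add_left, real_inner_smul_left, inner_toEuclideanLin_transpose]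
      rw [hf, hf, map_add, norm_add_sub_sq x, norm_add_sub_sq x, norm_add_sub_sq,
        add_sub_right_comm, map_add, norm_add_sq_real]
      ring)
    (by
      intro h hh
      have : 0 < ‖h‖ := norm_pos_iff.mpr hh
      rw [hquad]
      positivity)
  refine ⟨fun x => ?_, key.2⟩
  rw [hMx, hb, smul_right_inj hc.ne']
  exact key.1 x
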